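/- arXiv:2206.07316 — 9 statements merged into one kernel-verified Lean document; each statement's English description precedes it below -/
import Mathlib

section
/- Let E be a real normed space, L ≥ 0, and let f : E → ℝ be a convex L-Lipschitz function. Then the effective domain of f* is nonempty, and for every v ∈ E one has the biconjugate representation f(v) = sup { θ(v) − f*(θ) : θ a continuous linear functional with f*(θ) < ∞ }. -/
/-- The Fenchel conjugate value `f*(θ) = sup_v (θ v − f v)` (as a real number;
meaningful when the supremum is finite, i.e. on the effective domain). -/
noncomputable def fenchelConj {E : Type*} [NormedAddCommGroup E] [NormedSpace ℝ E]
    (f : E → ℝ) (θ : E →L[ℝ] ℝ) : ℝ :=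
  sSup (Set.range fun v => θ v - f v)

/-- `θ` lies in the effective domain of `f*`, i.e. `f*(θ) < ∞`. -/
def inConjDom {E : Type*} [NormedAddCommGroup E] [NormedSpace ℝ E]
    (f : E → ℝ) (θ : E →L[ℝ] ℝ) : Prop :=
  BddAbove (Set.range fun v => θ v - f v)

theorem ConvexOn.exists_affine_minorant_of_lt {E : Type*} [NormedAddCommGroup E] [NormedSpace ℝ E]
    {f : E → ℝ} (hconv : ConvexOn ℝ Set.univ f) (hcont : Continuous f) {v : E} {a : ℝ}
    (ha : a < f v) :
    ∃ (θ : E →L[ℝ] ℝ) (c : ℝ), (∀ w, θ w + c ≤ f w) ∧ a < θ v + c := by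
  obtain ⟨b, hab, hb⟩ := exists_between ha
  obtain ⟨θ, c, hle, heq⟩ := hconv.exists_affine_le_of_lt (𝕜 := ℝ) (Set.mem_univ v) hb
    isClosed_univ (hcont.lowerSemicontinuous.lowerSemicontinuousOn _)
  exact ⟨θ, c, fun w => hle ⟨w, Set.mem_univ w⟩, hab.trans_eq heq.symm⟩

theorem inConjDom_of_affine_le {E : Type*} [NormedAddCommGroup E] [NormedSpace ℝ E]
    {f : E → ℝ} {θ : E →L[ℝ] ℝ} {c : ℝ} (h : ∀ w, θ w + c ≤ f w) : inConjDom f θ := by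
  refine ⟨-c, ?_⟩
  rintro _ ⟨w, rfl⟩
  linarith [h w]

theorem fenchelConj_le_of_affine_le {E : Type*} [NormedAddCommGroup E] [NormedSpace ℝ E]
    {f : E → ℝ} {θ : E →L[ℝ] ℝ} {c : ℝ} (h : ∀ w, θ w + c ≤ f w) : fenchelConj f θ ≤ -c := by
  refine csSup_le (Set.range_nonempty _) ?_
  rintro _ ⟨w, rfl⟩
  linarith [h w]

/-- The Fenchel–Young inequality. -/
theorem inConjDom.sub_fenchelConj_le {E : Type*} [NormedAddCommGroup E] [NormedSpace ℝ E]
    {f : E → ℝ} {θ : E →L[ℝ] ℝ} (h : inConjDom f θ) (v : E) : θ v - fenchelConj f θ ≤ f v := by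
  have := le_csSup h (Set.mem_range_self v)
  change θ v - f v ≤ fenchelConj f θ at this
  linarith

/-- For a convex `L`-Lipschitz `f : E → ℝ`, the effective domain of `f*` is nonempty
and `f` equals its biconjugate: `f(v) = sup { θ v − f*(θ) : f*(θ) < ∞ }`. -/
theorem biconjugate_of_convex_lipschitz {E : Type*} [NormedAddCommGroup E] [NormedSpace ℝ E]
    (L : ℝ) (hL : 0 ≤ L) (f : E → ℝ)
    (hconv : ConvexOn ℝ Set.univ f)
    (hf : ∀ x y : E, |f x - f y| ≤ L * ‖x - y‖) :
    (∃ θ : E →L[ℝ] ℝ, inConjDom f θ) ∧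
      ∀ v : E, f v = sSup {z : ℝ | ∃ θ : E →L[ℝ] ℝ, inConjDom f θ ∧ z = θ v - fenchelConj f θ} := by
  have hcont : Continuous f :=
    (LipschitzWith.of_dist_le_mul (K := L.toNNReal) fun x y => by
      simpa [Real.dist_eq, ← dist_eq_norm x y, hL] using hf x y).continuous
  obtain ⟨θ₀, c₀, h₀, -⟩ := hconv.exists_affine_minorant_of_lt hcont (sub_one_lt (f 0))
  have hdom := inConjDom_of_affine_le h₀
  refine ⟨⟨θ₀, hdom⟩, fun v => Eq.symm ?_⟩
  refine csSup_eq_of_forall_le_of_forall_lt_exists_gt ⟨_, θ₀, hdom, rfl⟩ ?_ fun a ha => ?_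
  · rintro _ ⟨θ, hθ, rfl⟩
    exact hθ.sub_fenchelConj_le v
  · obtain ⟨θ, c, hle, hlt⟩ := hconv.exists_affine_minorant_of_lt hcont ha
    refine ⟨_, ⟨θ, inConjDom_of_affine_le hle, rfl⟩, ?_⟩
    linarith [fenchelConj_le_of_affine_le hle]
end

section
/- Let E be a finite-dimensional real normed space, let V ⊆ E be closed and convex with 0 ∈ V, and let B_V := inf_{w ∈ frontier V} ‖w‖ denote the distance from the origin to the topological frontier of V. If θ is a continuous linear functional on E with dual norm ‖θ‖_* = 1 that is bounded above on V, then d_V*(θ) ≥ B_V, where d_V* is the Fenchel conjugate of the distance function d_V. -/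
/-- An open ball around a point of `V` whose radius is the distance to the frontier lies in `V`. -/
theorem ball_infDist_frontier_subset {E : Type*} [NormedAddCommGroup E] [NormedSpace ℝ E]
    {V : Set E} {a : E} (ha : a ∈ V) :
    Metric.ball a (Metric.infDist a (frontier V)) ⊆ V := by
  intro x hx
  by_contra hxV
  have ha' : a ∈ Metric.ball a (Metric.infDist a (frontier V)) :=
    Metric.mem_ball_self (dist_nonneg.trans_lt (Metric.mem_ball.1 hx))
  have hpre : IsPreconnected (Metric.ball a (Metric.infDist a (frontier V))) :=
    (convex_ball a _).isPreconnected
  have hcover : ∀ y ∈ Metric.ball a (Metric.infDist a (frontier V)),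
      y ∈ interior V ∨ y ∉ closure V := by
    intro y hy
    by_contra! h
    have hle := Metric.infDist_le_dist_of_mem (x := a) (show y ∈ frontier V from ⟨h.2, h.1⟩)
    rw [Metric.mem_ball, dist_comm] at hy
    exact hle.not_gt hy
  have haV : a ∈ interior V := (hcover a ha').resolve_right (not_not.2 (subset_closure ha))
  have hxV' : x ∉ closure V := (hcover x hx).resolve_left fun h => hxV (interior_subset h)
  obtain ⟨y, -, hy, hy'⟩ := hpre _ _ isOpen_interior isClosed_closure.isOpen_compl hcover
    ⟨a, ha', haV⟩ ⟨x, hx, hxV'⟩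
  exact hy' (interior_subset_closure hy)

/-- The conjugate of the distance function dominates, on `V`, any functional of norm at most one
that is bounded above on `V`. -/
theorem apply_le_fenchelConj_infDist {E : Type*} [NormedAddCommGroup E] [NormedSpace ℝ E]
    {V : Set E} {θ : E →L[ℝ] ℝ} (hθ : ‖θ‖ ≤ 1)
    (hbdd : BddAbove ((fun v => θ v) '' V)) {v : E} (hv : v ∈ V) :
    θ v ≤ fenchelConj (fun w => Metric.infDist w V) θ := by
  have hrange : BddAbove (Set.range fun u => θ u - Metric.infDist u V) := by
    obtain ⟨M, hM⟩ := hbdd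
    refine ⟨M, ?_⟩
    rintro _ ⟨u, rfl⟩
    have h : θ u - M ≤ Metric.infDist u V := by
      refine (Metric.le_infDist ⟨v, hv⟩).2 fun {w} hw => ?_
      have h1 : θ w ≤ M := hM ⟨w, hw, rfl⟩
      have h2 : θ (u - w) ≤ ‖u - w‖ :=
        (le_abs_self _).trans ((θ.le_of_opNorm_le hθ _).trans_eq (one_mul _))
      rw [map_sub] at h2
      rw [dist_eq_norm]
      linarith
    change θ u - Metric.infDist u V ≤ M
    linarith
  have h := le_csSup hrange ⟨v, rfl⟩
  simpa only [Metric.infDist_zero_of_mem hv, sub_zero, fenchelConj] using h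

/-- For a closed convex `V ∋ 0` in a finite-dimensional normed space, and a functional
`θ` with `‖θ‖ = 1` bounded above on `V`, the conjugate of the distance function
satisfies `d_V*(θ) ≥ B_V`, the distance from the origin to the frontier of `V`. -/
theorem distConj_ge_BV {E : Type*} [NormedAddCommGroup E] [NormedSpace ℝ E]
    [FiniteDimensional ℝ E]
    (V : Set E) (hVcl : IsClosed V) (hVconv : Convex ℝ V) (h0V : (0 : E) ∈ V)
    (θ : E →L[ℝ] ℝ) (hθnorm : ‖θ‖ = 1)
    (hθbdd : BddAbove ((fun v => θ v) '' V)) :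
    Metric.infDist (0 : E) (frontier V) ≤ fenchelConj (fun w => Metric.infDist w V) θ := by
  by_contra! hlt
  have hball := ball_infDist_frontier_subset h0V
  have hle : ∀ v ∈ V, θ v ≤ fenchelConj (fun w => Metric.infDist w V) θ :=
    fun v hv => apply_le_fenchelConj_infDist hθnorm.le hθbdd hv
  have hS : 0 ≤ fenchelConj (fun w => Metric.infDist w V) θ := by
    simpa using hle 0 h0V
  set S := fenchelConj (fun w => Metric.infDist w V) θ
  set B := Metric.infDist (0 : E) (frontier V)
  have hB : 0 < B := hS.trans_lt hlt
  have hr : S / B < ‖θ‖ := by rwa [hθnorm, div_lt_one hB]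
  obtain ⟨x, hx, hθx⟩ := θ.exists_lt_apply_of_lt_opNorm hr
  have hmem : ∀ y : E, ‖y‖ < 1 → B • y ∈ V := fun y hy => hball <| by
    rw [mem_ball_zero_iff, norm_smul, Real.norm_of_nonneg hB.le]
    exact mul_lt_of_lt_one_right hB hy
  have h1 := hle _ (hmem x hx)
  have h2 := hle _ (hmem (-x) (by rwa [norm_neg]))
  rw [map_smul, smul_eq_mul] at h1 h2
  rw [map_neg] at h2
  rw [div_lt_iff₀ hB, Real.norm_eq_abs] at hθx
  rcases abs_cases (θ x) with ⟨h, -⟩ | ⟨h, -⟩ <;> rw [h] at hθx <;> linarith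
end

section
/- Let E be a finite-dimensional real normed space, let V ⊆ E be closed and convex with 0 ∈ V, and let B_V := inf_{w ∈ frontier V} ‖w‖ denote the distance from the origin to the topological frontier of V. Then for every v ∉ V and every κ ∈ [0, 1], there exists a continuous linear functional θ on E with dual norm ‖θ‖_* ≤ 1 and d_V*(θ) < ∞ such that κ·d_V*(θ) − θ(v) ≤ (κ − 1)·B_V, where d_V* is the Fenchel conjugate of the distance function d_V. -/
open Metric in
/-- A point at distance from `0 ∈ V` less than the distance to the frontier lies in `V`. -/
theorem mem_of_norm_lt_infDist_frontier {E : Type*} [NormedAddCommGroup E] [NormedSpace ℝ E]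
    {V : Set E} (h0V : (0 : E) ∈ V) {x : E} (hx : ‖x‖ < infDist (0 : E) (frontier V)) :
    x ∈ V := by
  by_contra hxV
  have hB : 0 < infDist (0 : E) (frontier V) := (norm_nonneg x).trans_lt hx
  have hsub : ball (0 : E) (infDist (0 : E) (frontier V)) ⊆ interior V ∪ interior Vᶜ := by
    rw [← compl_frontier_eq_union_interior]
    exact disjoint_ball_infDist.subset_compl_right
  have h0 := mem_ball_self (x := (0 : E)) hB
  have hx' := mem_ball_zero_iff.2 hx
  have h0i : (0 : E) ∈ interior V :=
    (hsub h0).resolve_right fun h => interior_subset h h0V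
  have hxi : x ∈ interior Vᶜ := (hsub hx').resolve_left fun h => hxV (interior_subset h)
  obtain ⟨y, -, hy, hyc⟩ := (convex_ball (0 : E) _).isPreconnected _ _ isOpen_interior
    isOpen_interior hsub ⟨0, h0, h0i⟩ ⟨x, hx', hxi⟩
  exact interior_subset hyc (interior_subset hy)

/-- A functional of norm at least one takes, on the open unit ball scaled by `B`,
values with supremum at least `B`. -/
theorem le_of_forall_norm_lt_apply_le {E : Type*} [NormedAddCommGroup E] [NormedSpace ℝ E]
    {θ : E →L[ℝ] ℝ} (hθ : 1 ≤ ‖θ‖) {B c : ℝ} (hc : 0 ≤ c)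
    (h : ∀ x : E, ‖x‖ < B → θ x ≤ c) : B ≤ c := by
  by_contra! hcB
  have hB : 0 < B := hc.trans_lt hcB
  obtain ⟨x, hx, hcx⟩ := θ.exists_lt_apply_of_lt_opNorm (((div_lt_one hB).2 hcB).trans_le hθ)
  have hnorm : ‖B • x‖ < B := by
    rw [norm_smul, Real.norm_of_nonneg hB.le]
    exact mul_lt_of_lt_one_right hB hx
  have h₁ := h (B • x) hnorm
  have h₂ := h (-(B • x)) (by rwa [norm_neg])
  rw [map_neg] at h₂
  rw [map_smul, smul_eq_mul] at h₁ h₂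
  rw [div_lt_iff₀ hB, Real.norm_eq_abs] at hcx
  rcases abs_cases (θ x) with ⟨ha, -⟩ | ⟨ha, -⟩ <;> rw [ha] at hcx <;> linarith

/-- A point outside a closed convex set containing the origin is separated from it by a
functional of norm one. -/
theorem exists_norm_eq_one_forall_mem_le {E : Type*} [NormedAddCommGroup E] [NormedSpace ℝ E]
    {V : Set E} (hVcl : IsClosed V) (hVconv : Convex ℝ V) (h0V : (0 : E) ∈ V)
    {v : E} (hv : v ∉ V) : ∃ θ : E →L[ℝ] ℝ, ‖θ‖ = 1 ∧ ∀ a ∈ V, θ a ≤ θ v := by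
  obtain ⟨f, u, hfV, hfv⟩ := geometric_hahn_banach_closed_point hVconv hVcl hv
  have hf : f ≠ 0 := by
    rintro rfl
    have h0 := hfV 0 h0V
    simp only [zero_apply] at h0 hfv
    exact lt_asymm h0 hfv
  refine ⟨‖f‖⁻¹ • f, ?_, fun a ha => ?_⟩
  · rw [norm_smul, norm_inv, norm_norm, inv_mul_cancel₀ (norm_ne_zero_iff.2 hf)]
  · exact mul_le_mul_of_nonneg_left ((hfV a ha).trans hfv).le (inv_nonneg.2 (norm_nonneg f))

/-- A bound on `V` for a functional of norm at most one bounds `θ w - d_V w` everywhere. -/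
theorem apply_sub_infDist_le {E : Type*} [NormedAddCommGroup E] [NormedSpace ℝ E]
    {V : Set E} (hV : V.Nonempty) {θ : E →L[ℝ] ℝ} (hθ : ‖θ‖ ≤ 1) {c : ℝ}
    (h : ∀ a ∈ V, θ a ≤ c) (w : E) : θ w - Metric.infDist w V ≤ c := by
  suffices θ w - c ≤ Metric.infDist w V by linarith
  refine (Metric.le_infDist hV).2 fun a ha => ?_
  have h₁ : θ (w - a) ≤ ‖w - a‖ :=
    (le_abs_self _).trans (θ.le_of_opNorm_le_of_le hθ le_rfl |>.trans_eq (one_mul _))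
  rw [map_sub] at h₁
  rw [dist_eq_norm]
  linarith [h a ha]

/-- Key property of `B_V` (Lemma `property-bv`): for a closed convex `V ∋ 0` in a
finite-dimensional normed space, every `v ∉ V` and `κ ∈ [0,1]` admit a dual functional
`θ` with `‖θ‖ ≤ 1`, `d_V*(θ) < ∞`, and `κ·d_V*(θ) − θ(v) ≤ (κ − 1)·B_V`. -/
theorem exists_dual_BV {E : Type*} [NormedAddCommGroup E] [NormedSpace ℝ E]
    [FiniteDimensional ℝ E]
    (V : Set E) (hVcl : IsClosed V) (hVconv : Convex ℝ V) (h0V : (0 : E) ∈ V)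
    (v : E) (hv : v ∉ V) (κ : ℝ) (hκ : κ ∈ Set.Icc (0 : ℝ) 1) :
    ∃ θ : E →L[ℝ] ℝ, ‖θ‖ ≤ 1 ∧ inConjDom (fun w => Metric.infDist w V) θ ∧
      κ * fenchelConj (fun w => Metric.infDist w V) θ - θ v ≤
        (κ - 1) * Metric.infDist (0 : E) (frontier V) := by
  obtain ⟨θ, hθ, hθV⟩ := exists_norm_eq_one_forall_mem_le hVcl hVconv h0V hv
  have hub : ∀ y ∈ Set.range fun w => θ w - Metric.infDist w V, y ≤ θ v := by
    rintro _ ⟨w, rfl⟩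
    exact apply_sub_infDist_le ⟨0, h0V⟩ hθ.le hθV w
  have hbdd : inConjDom (fun w => Metric.infDist w V) θ := ⟨θ v, hub⟩
  refine ⟨θ, hθ.le, hbdd, ?_⟩
  have hle : fenchelConj (fun w => Metric.infDist w V) θ ≤ θ v :=
    csSup_le (Set.range_nonempty _) hub
  have hmem : ∀ x ∈ V, θ x ≤ fenchelConj (fun w => Metric.infDist w V) θ := fun x hx =>
    le_csSup hbdd ⟨x, by simp [Metric.infDist_zero_of_mem hx]⟩
  have hB : Metric.infDist (0 : E) (frontier V) ≤ fenchelConj (fun w => Metric.infDist w V) θ :=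
    le_of_forall_norm_lt_apply_le hθ.ge ((map_zero θ).ge.trans (hmem 0 h0V)) fun x hx =>
      hmem x (mem_of_norm_lt_infDist_frontier h0V hx)
  have hκB := mul_le_mul_of_nonneg_left hB (sub_nonneg.2 hκ.2)
  linarith
end

section
/- (Online mirror descent regret bound.) Let E be a finite-dimensional real normed space, let Λ ⊆ E be nonempty, closed, and convex, and let h : E → ℝ be Fréchet differentiable with Bregman distance B_h(x, y) := h(x) − h(y) − Dh(y)(x − y). Assume B_h(x, y) ≥ (1/2)‖x − y‖² for all x, y ∈ Λ (1-strong convexity on Λ) and B_h(x, y) ≤ D for all x, y ∈ Λ, for some D > 0. Let T ≥ 1, let ξ_1, …, ξ_T : E → ℝ be convex functions, let λ_1 ∈ Λ, and for each t let g_t be a continuous linear functional on E satisfying the subgradient inequality ξ_t(λ) ≥ ξ_t(λ_t) + g_t(λ − λ_t) for all λ ∈ Λ and the bound ‖g_t‖_* ≤ G for some G > 0. Suppose the iterates satisfy the mirror descent update with constant step size η = √D / (G√T): for each t, λ_{t+1} ∈ Λ and η·g_t(λ_{t+1}) + B_h(λ_{t+1}, λ_t) ≤ η·g_t(λ) + B_h(λ,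 λ_t) for all λ ∈ Λ. Then for every λ ∈ Λ, the regret satisfies Σ_{t=1}^T (ξ_t(λ_t) − ξ_t(λ)) ≤ 2·G·√(D·T). -/
/-- First-order optimality of a minimizer on a convex set, for a linear functional plus a
differentiable function. -/
theorem fderiv_add_nonneg_of_isMinOn_convex {E : Type*} [NormedAddCommGroup E] [NormedSpace ℝ E]
    {s : Set E} (hs : Convex ℝ s) {h : E → ℝ} {x l : E} (hx : x ∈ s) (hl : l ∈ s)
    (hdiff : DifferentiableAt ℝ h x) (φ : E →L[ℝ] ℝ)
    (hmin : ∀ z ∈ s, h x + φ x ≤ h z + φ z) :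
    0 ≤ (fderiv ℝ h x + φ) (l - x) := by
  have hloc : IsLocalMinOn (fun z => h z + φ z) s x :=
    IsMinOn.localize (isMinOn_iff.2 hmin)
  exact hloc.hasFDerivWithinAt_nonneg (hdiff.hasFDerivAt.add φ.hasFDerivAt).hasFDerivWithinAt
    (sub_mem_posTangentConeAt_of_segment_subset (hs.segment_subset hx hl))

/-- Online mirror descent regret bound (Theorem 2.15 of Shalev-Shwartz 2012):
with a 1-strongly-convex, `D`-bounded Bregman distance on `Λ`, subgradients bounded
by `G`, and constant step size `η = √D/(G√T)`, the regret is at most `2G√(DT)`. -/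
theorem online_mirror_descent_regret {E : Type*} [NormedAddCommGroup E] [NormedSpace ℝ E]
    [FiniteDimensional ℝ E]
    (Λ : Set E) (hΛne : Λ.Nonempty) (hΛcl : IsClosed Λ) (hΛconv : Convex ℝ Λ)
    (h : E → ℝ) (hdiff : Differentiable ℝ h)
    (B : E → E → ℝ)
    (hB : ∀ x y : E, B x y = h x - h y - fderiv ℝ h y (x - y))
    (D G : ℝ) (hD : 0 < D) (hG : 0 < G)
    (hstrong : ∀ x ∈ Λ, ∀ y ∈ Λ, (1 / 2) * ‖x - y‖ ^ 2 ≤ B x y)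
    (hbound : ∀ x ∈ Λ, ∀ y ∈ Λ, B x y ≤ D)
    (T : ℕ) (hT : 1 ≤ T)
    (ξ : ℕ → E → ℝ) (hξ : ∀ t, ConvexOn ℝ Set.univ (ξ t))
    (lam : ℕ → E) (hlam : ∀ t, lam t ∈ Λ)
    (g : ℕ → E →L[ℝ] ℝ)
    (hsub : ∀ t, ∀ l ∈ Λ, ξ t (lam t) + g t (l - lam t) ≤ ξ t l)
    (hgnorm : ∀ t, ‖g t‖ ≤ G)
    (η : ℝ) (hη : η = Real.sqrt D / (G * Real.sqrt T))
    (hupdate : ∀ t, ∀ l ∈ Λ,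
      η * g t (lam (t + 1)) + B (lam (t + 1)) (lam t) ≤ η * g t l + B l (lam t)) :
    ∀ l ∈ Λ, ∑ t ∈ Finset.range T, (ξ t (lam t) - ξ t l) ≤ 2 * G * Real.sqrt (D * T) := by
  intro l hl
  have hstep : ∀ t, η * (ξ t (lam t) - ξ t l) ≤
      (B l (lam t) - B l (lam (t + 1))) + (η * G) ^ 2 / 2 := by
    intro t
    have hη0 : 0 ≤ η := by rw [hη]; positivity
    have hopt := fderiv_add_nonneg_of_isMinOn_convex hΛconv (hlam (t + 1)) hl
      (hdiff (lam (t + 1))) (η • g t - fderiv ℝ h (lam t)) (by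
        intro z hz
        have := hupdate t z hz
        simp only [hB, map_sub, sub_apply, smul_apply,
          smul_eq_mul] at this ⊢
        linarith)
    have hst := hstrong _ (hlam (t + 1)) _ (hlam t)
    have hs := mul_le_mul_of_nonneg_left (hsub t l hl) hη0
    have hdual : g t (lam t - lam (t + 1)) ≤ G * ‖lam (t + 1) - lam t‖ := by
      rw [norm_sub_rev]
      exact (le_abs_self _).trans ((g t).le_of_opNorm_le (hgnorm t) _)
    have hd := mul_le_mul_of_nonneg_left hdual hη0
    simp only [hB, map_sub, add_apply, sub_apply,
      smul_apply, smul_eq_mul] at hopt hst hs hd ⊢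
    nlinarith [sq_nonneg (η * G - ‖lam (t + 1) - lam t‖)]
  have hsum : η * ∑ t ∈ Finset.range T, (ξ t (lam t) - ξ t l) ≤
      D + T * ((η * G) ^ 2 / 2) := by
    have hle := Finset.sum_le_sum fun t (_ : t ∈ Finset.range T) => hstep t
    rw [← Finset.mul_sum, Finset.sum_add_distrib, Finset.sum_range_sub', Finset.sum_const,
      Finset.card_range, nsmul_eq_mul] at hle
    have hnonneg : 0 ≤ B l (lam T) := le_trans (by positivity) (hstrong l hl _ (hlam T))
    linarith [hbound l hl _ (hlam 0)]
  have hTpos : (0 : ℝ) < T := by exact_mod_cast hT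
  have hsD := Real.sqrt_pos.2 hD
  have hsT := Real.sqrt_pos.2 hTpos
  have hη0 : 0 < η := by rw [hη]; positivity
  have hηG : η * G * √T = √D := by rw [hη]; field_simp
  have hTη : T * (η * G) ^ 2 = D := by
    rw [← Real.sq_sqrt hD.le, ← hηG, mul_pow _ √T, Real.sq_sqrt hTpos.le, mul_comm]
  have hrhs : η * (2 * G * √(D * T)) = 2 * D := by
    rw [Real.sqrt_mul hD.le]
    calc η * (2 * G * (√D * √T)) = 2 * (η * G * √T) * √D := by ring
      _ = 2 * D := by rw [hηG, mul_assoc, Real.mul_self_sqrt hD.le]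
  refine le_of_mul_le_mul_left ?_ hη0
  linarith
end

section
/- (Calibration transfers surrogate risk bounds to SPO risk bounds.) Let (S, μ) and (X, ν) be probability spaces, let Ω be a nonempty countable index set, and let F, G : S × Ω × X → [0, ∞) be functions that are jointly measurable in (s, x) for each fixed ω ∈ Ω. Let κ₁, κ₂ > 0, β ≥ 1, γ > 0, and let n be a positive integer. Assume: (i) (pointwise calibration) for all s ∈ S, ω ∈ Ω, x ∈ X, and ε > 0, if G(s, ω, x) ≤ κ₁·ε^β then F(s, ω, x) ≤ ε; and (ii) (surrogate risk bound) ∫_S sup_{ω ∈ Ω} ( ∫_X G(s, ω, x) dν(x) ) dμ(s) ≤ κ₂·n^{−γ}. Then ∫_S sup_{ω ∈ Ω} ( ∫_X F(s, ω, x) dν(x) ) dμ(s) ≤ (κ₂/κ₁)^{1/β} · n^{−γ/β}. -/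
open MeasureTheory ENNReal

theorem rpow_lintegral_le_lintegral_rpow {α : Type*} [MeasurableSpace α] {μ : Measure α}
    [IsProbabilityMeasure μ] {f : α → ℝ≥0∞} (hf : AEMeasurable f μ) {p : ℝ} (hp : 1 ≤ p) :
    (∫⁻ a, f a ∂μ) ^ p ≤ ∫⁻ a, f a ^ p ∂μ := by
  have hp0 : 0 < p := zero_lt_one.trans_le hp
  have h := eLpNorm'_le_eLpNorm'_of_exponent_le one_pos hp μ hf.aestronglyMeasurable
  simp only [eLpNorm', enorm_eq_self, rpow_one, div_one] at h
  simpa only [one_div, rpow_inv_rpow hp0.ne'] using rpow_le_rpow h hp0.le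

theorem iSup_rpow {ι : Sort*} (f : ι → ℝ≥0∞) {p : ℝ} (hp : 0 < p) :
    (⨆ i, f i) ^ p = ⨆ i, f i ^ p :=
  (orderIsoRpow p hp).map_iSup f

/-- A calibration implication `g ≤ κ * ε ^ β → f ≤ ε` at all scales amounts to
`κ * f ^ β ≤ g`. -/
theorem mul_rpow_le_of_calibrated {f g : ℝ≥0∞} (hg : g ≠ ⊤) {κ β : ℝ} (hκ : 0 < κ) (hβ : 0 < β)
    (h : ∀ ε : ℝ, 0 < ε → g ≤ ENNReal.ofReal (κ * ε ^ β) → f ≤ ENNReal.ofReal ε) :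
    ENNReal.ofReal κ * f ^ β ≤ g := by
  rcases eq_or_ne g 0 with rfl | hg0
  · have hf : f = 0 := by
      refine nonpos_iff_eq_zero.1 (ENNReal.le_of_forall_pos_le_add fun ε hε _ => ?_)
      simpa using h ε hε zero_le
    simp [hf, hβ]
  · have hgpos : 0 < g.toReal := toReal_pos hg0 hg
    set ε := (g.toReal / κ) ^ β⁻¹ with hε_def
    have hε : 0 < ε := by positivity
    have hεβ : κ * ε ^ β = g.toReal := by
      rw [hε_def, Real.rpow_inv_rpow (by positivity) hβ.ne']
      field_simp
    calc ENNReal.ofReal κ * f ^ β ≤ ENNReal.ofReal κ * ENNReal.ofReal ε ^ β := by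
          gcongr
          exact h ε hε (by rw [hεβ, ofReal_toReal hg])
      _ = g := by
          rw [ofReal_rpow_of_pos hε, ← ofReal_mul hκ.le, hεβ, ofReal_toReal hg]

open MeasureTheory ENNReal

/-- Uniform calibration transfers surrogate risk bounds to SPO risk bounds:
if pointwise `G ≤ κ₁·ε^β ⇒ F ≤ ε` and the expected sup (over `ω`) surrogate risk is at
most `κ₂·n^{−γ}`, then the expected sup SPO risk is at most `(κ₂/κ₁)^{1/β}·n^{−γ/β}`. -/
theorem calibration_risk_transfer {S X Ω : Type*} [MeasurableSpace S] [MeasurableSpace X]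
    [Countable Ω] [Nonempty Ω]
    (μ : Measure S) (ν : Measure X) [IsProbabilityMeasure μ] [IsProbabilityMeasure ν]
    (F G : S → Ω → X → ℝ≥0∞)
    (hFfin : ∀ s ω x, F s ω x ≠ ⊤) (hGfin : ∀ s ω x, G s ω x ≠ ⊤)
    (hFmeas : ∀ ω, Measurable (fun p : S × X => F p.1 ω p.2))
    (hGmeas : ∀ ω, Measurable (fun p : S × X => G p.1 ω p.2))
    (κ₁ κ₂ β γ : ℝ) (hκ₁ : 0 < κ₁) (hκ₂ : 0 < κ₂) (hβ : 1 ≤ β) (hγ : 0 < γ)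
    (n : ℕ) (hn : 0 < n)
    (hcal : ∀ s ω x, ∀ ε : ℝ, 0 < ε →
      G s ω x ≤ ENNReal.ofReal (κ₁ * ε ^ β) → F s ω x ≤ ENNReal.ofReal ε)
    (hrisk : ∫⁻ s, ⨆ ω, ∫⁻ x, G s ω x ∂ν ∂μ ≤ ENNReal.ofReal (κ₂ * (n : ℝ) ^ (-γ))) :
    ∫⁻ s, ⨆ ω, ∫⁻ x, F s ω x ∂ν ∂μ ≤
      ENNReal.ofReal ((κ₂ / κ₁) ^ (1 / β) * (n : ℝ) ^ (-γ / β)) := by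
  have hβ0 : 0 < β := zero_lt_one.trans_le hβ
  have hn' : (0 : ℝ) < n := Nat.cast_pos.2 hn
  have hpt : ∀ s, ENNReal.ofReal κ₁ * (⨆ ω, ∫⁻ x, F s ω x ∂ν) ^ β ≤ ⨆ ω, ∫⁻ x, G s ω x ∂ν := by
    intro s
    rw [iSup_rpow _ hβ0, ENNReal.mul_iSup]
    refine iSup_mono fun ω => ?_
    have hF : Measurable (F s ω) := (hFmeas ω).comp measurable_prodMk_left
    calc ENNReal.ofReal κ₁ * (∫⁻ x, F s ω x ∂ν) ^ β
        ≤ ENNReal.ofReal κ₁ * ∫⁻ x, F s ω x ^ β ∂ν := by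
          gcongr
          exact rpow_lintegral_le_lintegral_rpow hF.aemeasurable hβ
      _ = ∫⁻ x, ENNReal.ofReal κ₁ * F s ω x ^ β ∂ν :=
          (lintegral_const_mul' _ _ ofReal_ne_top).symm
      _ ≤ ∫⁻ x, G s ω x ∂ν := lintegral_mono fun x =>
          mul_rpow_le_of_calibrated (hGfin s ω x) hκ₁ hβ0 (hcal s ω x)
  have hmeas : Measurable fun s => ⨆ ω, ∫⁻ x, F s ω x ∂ν :=
    Measurable.iSup fun ω => (hFmeas ω).lintegral_prod_right'
  refine (rpow_le_rpow_iff hβ0).1 ((ENNReal.mul_le_mul_iff_right (a := ENNReal.ofReal κ₁)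
    (by simpa using hκ₁) ofReal_ne_top).1 ?_)
  calc ENNReal.ofReal κ₁ * (∫⁻ s, ⨆ ω, ∫⁻ x, F s ω x ∂ν ∂μ) ^ β
      ≤ ENNReal.ofReal κ₁ * ∫⁻ s, (⨆ ω, ∫⁻ x, F s ω x ∂ν) ^ β ∂μ := by
        gcongr
        exact rpow_lintegral_le_lintegral_rpow hmeas.aemeasurable hβ
    _ = ∫⁻ s, ENNReal.ofReal κ₁ * (⨆ ω, ∫⁻ x, F s ω x ∂ν) ^ β ∂μ :=
        (lintegral_const_mul' _ _ ofReal_ne_top).symm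
    _ ≤ ∫⁻ s, ⨆ ω, ∫⁻ x, G s ω x ∂ν ∂μ := lintegral_mono hpt
    _ ≤ ENNReal.ofReal (κ₂ * (n : ℝ) ^ (-γ)) := hrisk
    _ = ENNReal.ofReal κ₁ *
        ENNReal.ofReal ((κ₂ / κ₁) ^ (1 / β) * (n : ℝ) ^ (-γ / β)) ^ β := by
        rw [ofReal_rpow_of_pos (by positivity), ← ofReal_mul hκ₁.le,
          Real.mul_rpow (by positivity) (by positivity), ← Real.rpow_mul (by positivity),
          ← Real.rpow_mul hn'.le, div_mul_cancel₀ _ hβ0.ne', div_mul_cancel₀ _ hβ0.ne',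
          Real.rpow_one, ← mul_assoc, mul_div_cancel₀ _ hκ₁.ne']
end

section
/- (Deterministic core of the soft-constraint dual regret bound, utility part.) Let E be a finite-dimensional real normed space and let u : E → ℝ be concave and L-Lipschitz for some L ≥ 0. Let Λ denote the effective domain of the Fenchel conjugate (−u)*. Let T ≥ 1, let v_1, …, v_T ∈ E, let λ_1, …, λ_T ∈ Λ be continuous linear functionals, let c ∈ E, and let R ≥ 0. Assume the mirror-descent regret bound: for every λ ∈ Λ, Σ_{t=1}^T ( −λ_t(v_t) + (−u)*(λ_t) + λ(v_t) − (−u)*(λ) ) ≤ R. Then, with v_avg := (1/T)·Σ_{t=1}^T v_t, one has Σ_{t=1}^T λ_t(c − v_t) ≤ T·( u(v_avg) − u(c) ) + R. -/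
/-- The Fenchel–Young inequality. -/
theorem apply_sub_le_fenchelConj {E : Type*} [NormedAddCommGroup E] [NormedSpace ℝ E]
    {f : E → ℝ} {θ : E →L[ℝ] ℝ} (hθ : inConjDom f θ) (w : E) :
    θ w - f w ≤ fenchelConj f θ :=
  le_csSup hθ ⟨w, rfl⟩

/-- A continuous convex function is pointwise the supremum of `θ x - f* θ` over `θ ∈ dom f*`. -/
theorem exists_inConjDom_le_sub_fenchelConj {E : Type*} [NormedAddCommGroup E] [NormedSpace ℝ E]
    {f : E → ℝ} (hf : ConvexOn ℝ Set.univ f) (hcont : Continuous f) {x : E} {a : ℝ}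
    (ha : a < f x) : ∃ θ : E →L[ℝ] ℝ, inConjDom f θ ∧ a ≤ θ x - fenchelConj f θ := by
  obtain ⟨θ, b, hle, heq⟩ := hf.exists_affine_le_of_lt (𝕜 := ℝ) (Set.mem_univ x) ha
    isClosed_univ (hcont.lowerSemicontinuous.lowerSemicontinuousOn _)
  have hle' (w : E) : θ w + b ≤ f w := by simpa using hle ⟨w, Set.mem_univ w⟩
  have hbound : ∀ y ∈ Set.range fun w => θ w - f w, y ≤ -b := by
    rintro _ ⟨w, rfl⟩
    linarith [hle' w]
  have hconj : fenchelConj f θ ≤ -b := csSup_le (Set.range_nonempty _) hbound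
  have heq' : θ x + b = a := by simpa using heq
  exact ⟨θ, ⟨-b, hbound⟩, by linarith⟩

/-- Deterministic core of the soft-constraint dual regret bound, utility part:
from the mirror-descent regret bound over `Λ = dom (−u)*`, one gets
`Σ_t λ_t(c − v_t) ≤ T·(u(v_avg) − u(c)) + R`. -/
theorem soft_dual_regret_utility {E : Type*} [NormedAddCommGroup E] [NormedSpace ℝ E]
    [FiniteDimensional ℝ E]
    (u : E → ℝ) (L : ℝ) (hL : 0 ≤ L)
    (hconc : ConcaveOn ℝ Set.univ u)
    (hLip : ∀ x y : E, |u x - u y| ≤ L * ‖x - y‖)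
    (T : ℕ) (hT : 1 ≤ T)
    (v : ℕ → E) (lam : ℕ → E →L[ℝ] ℝ)
    (hlam : ∀ t, t < T → inConjDom (fun w => -u w) (lam t))
    (c : E) (R : ℝ) (hR : 0 ≤ R)
    (hmd : ∀ l : E →L[ℝ] ℝ, inConjDom (fun w => -u w) l →
      ∑ t ∈ Finset.range T,
        (-(lam t (v t)) + fenchelConj (fun w => -u w) (lam t)
          + l (v t) - fenchelConj (fun w => -u w) l) ≤ R) :
    ∑ t ∈ Finset.range T, lam t (c - v t) ≤
      (T : ℝ) * (u ((T : ℝ)⁻¹ • ∑ t ∈ Finset.range T, v t) - u c) + R := by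
  have hT0 : (0 : ℝ) < T := by exact_mod_cast hT
  have hcont : Continuous u :=
    (LipschitzWith.of_dist_le_mul (K := ⟨L, hL⟩) fun x y => by
      rw [Real.dist_eq, dist_eq_norm]
      exact hLip x y).continuous
  set x := (T : ℝ)⁻¹ • ∑ t ∈ Finset.range T, v t with hx
  set S := ∑ t ∈ Finset.range T, lam t (c - v t) with hS
  suffices h : -u x ≤ (R - T * u c - S) / T by
    rw [le_div_iff₀ hT0] at h
    linarith
  refine le_of_forall_lt_imp_le_of_dense fun a ha => ?_
  rw [le_div_iff₀ hT0]
  obtain ⟨l, hl, hal⟩ := exists_inConjDom_le_sub_fenchelConj hconc.neg hcont.neg ha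
  change a ≤ l x - fenchelConj (fun w => -u w) l at hal
  have hsum : ∑ t ∈ Finset.range T, l (v t) = T * l x := by
    rw [hx, map_smul, map_sum, smul_eq_mul, mul_inv_cancel_left₀ hT0.ne']
  have hlower : S + T * u c + T * l x - T * fenchelConj (fun w => -u w) l ≤ R := by
    refine le_trans ?_ (hmd l hl)
    calc S + T * u c + T * l x - T * fenchelConj (fun w => -u w) l
        = ∑ t ∈ Finset.range T,
            (lam t (c - v t) + u c + l (v t) - fenchelConj (fun w => -u w) l) := by
          simp [Finset.sum_add_distrib, Finset.sum_sub_distrib, hsum, hS]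
      _ ≤ _ := by
          refine Finset.sum_le_sum fun t ht => ?_
          have hFY := apply_sub_le_fenchelConj (hlam t (Finset.mem_range.1 ht)) c
          rw [map_sub]
          linarith
  have hscaled := mul_le_mul_of_nonneg_left hal hT0.le
  linarith
end

section
/- (Deterministic core of the soft-constraint dual regret bound, feasibility part.) Let E be a finite-dimensional real normed space and let V ⊆ E be nonempty, closed, and convex with distance function d_V. Let Θ denote the effective domain of the Fenchel conjugate d_V*. Let T ≥ 1, let v_1, …, v_T ∈ E, let θ_1, …, θ_T ∈ Θ be continuous linear functionals, let c ∈ V, and let R ≥ 0. Assume the mirror-descent regret bound: for every θ ∈ Θ, Σ_{t=1}^T ( −θ_t(v_t) + d_V*(θ_t) + θ(v_t) − d_V*(θ) ) ≤ R. Then, with v_avg := (1/T)·Σ_{t=1}^T v_t, one has Σ_{t=1}^T θ_t(c − v_t) ≤ −T·d_V(v_avg) + R. -/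
/-- The Fenchel–Young inequality. -/
theorem le_fenchelConj {E : Type*} [NormedAddCommGroup E] [NormedSpace ℝ E]
    {f : E → ℝ} {θ : E →L[ℝ] ℝ} (h : inConjDom f θ) (v : E) : θ v - f v ≤ fenchelConj f θ :=
  le_csSup h ⟨v, rfl⟩

/-- A continuous linear functional bounded above by `u` on the ball of radius `r` around `a`
satisfies `f a + r * ‖f‖ ≤ u`. -/
theorem apply_add_mul_norm_le_of_ball {E : Type*} [NormedAddCommGroup E] [NormedSpace ℝ E]
    (f : E →L[ℝ] ℝ) {a : E} {r u : ℝ} (hr : 0 < r) (h : ∀ x ∈ Metric.ball a r, f x ≤ u) :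
    f a + r * ‖f‖ ≤ u := by
  have key : ∀ x : E, ‖x‖ < 1 → f a + r * f x ≤ u := by
    intro x hx
    have := h (a + r • x) (by
      rw [mem_ball_iff_norm, add_sub_cancel_left, norm_smul, Real.norm_of_nonneg hr.le]
      nlinarith)
    simpa using this
  have hf : ‖f‖ ≤ (u - f a) / r := by
    rw [← f.sSup_unit_ball_eq_norm]
    refine csSup_le ((Metric.nonempty_ball.2 one_pos).image _) ?_
    rintro _ ⟨x, hx, rfl⟩
    rw [mem_ball_zero_iff] at hx
    have h1 := key x hx
    have h2 := key (-x) (by rwa [norm_neg])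
    rw [map_neg] at h2
    rw [le_div_iff₀ hr]
    change |f x| * r ≤ _
    rcases abs_cases (f x) with ⟨h3, -⟩ | ⟨h3, -⟩ <;> rw [h3] <;> linarith
  rw [le_div_iff₀ hr] at hf
  linarith

/-- The distance function to a nonempty convex set is dominated at each point by its
biconjugate, with the supremum attained. -/
theorem exists_infDist_le_sub_fenchelConj {E : Type*} [NormedAddCommGroup E] [NormedSpace ℝ E]
    {V : Set E} (hne : V.Nonempty) (hconv : Convex ℝ V) (a : E) :
    ∃ θ : E →L[ℝ] ℝ, inConjDom (fun w => Metric.infDist w V) θ ∧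
      Metric.infDist a V ≤ θ a - fenchelConj (fun w => Metric.infDist w V) θ := by
  suffices H : ∃ (θ : E →L[ℝ] ℝ) (C : ℝ), (∀ w, θ w - Metric.infDist w V ≤ C) ∧
      Metric.infDist a V ≤ θ a - C by
    obtain ⟨θ, C, hC, ha⟩ := H
    have hb : ∀ y ∈ Set.range fun w => θ w - Metric.infDist w V, y ≤ C := by
      rintro _ ⟨w, rfl⟩
      exact hC w
    exact ⟨θ, ⟨C, hb⟩, ha.trans (sub_le_sub_left (csSup_le (Set.range_nonempty _) hb) _)⟩
  rcases (Metric.infDist_nonneg (x := a) (s := V)).eq_or_lt with h0 | hpos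
  · refine ⟨0, 0, fun w => ?_, ?_⟩
    · simpa using Metric.infDist_nonneg
    · simp [← h0]
  · obtain ⟨f, u, hfu, huf⟩ := geometric_hahn_banach_open (convex_ball a (Metric.infDist a V))
      Metric.isOpen_ball hconv Metric.disjoint_ball_infDist
    have hnorm := apply_add_mul_norm_le_of_ball f hpos fun x hx => (hfu x hx).le
    have hfpos : 0 < ‖f‖ := by
      rw [norm_pos_iff]
      rintro rfl
      obtain ⟨b, hb⟩ := hne
      exact absurd ((hfu a (Metric.mem_ball_self hpos)).trans_le (huf b hb)) (by simp)
    refine ⟨-(‖f‖⁻¹ • f), -(‖f‖⁻¹ * u), fun w => ?_, ?_⟩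
    · have hw : ‖f‖⁻¹ * (u - f w) ≤ Metric.infDist w V := by
        refine (Metric.le_infDist hne).2 fun b hb => ?_
        rw [inv_mul_le_iff₀ hfpos, dist_comm, dist_eq_norm]
        have h1 := (le_abs_self _).trans (f.le_opNorm (b - w))
        rw [map_sub] at h1
        linarith [huf b hb]
      simp only [neg_apply, smul_apply, smul_eq_mul]
      linarith
    · have : Metric.infDist a V ≤ ‖f‖⁻¹ * (u - f a) := by
        rw [le_inv_mul_iff₀ hfpos]
        linarith
      simp only [neg_apply, smul_apply, smul_eq_mul]
      linarith

/-- Deterministic core of the soft-constraint dual regret bound, feasibility part: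
from the mirror-descent regret bound over `Θ = dom d_V*` and a feasible comparator
`c ∈ V`, one gets `Σ_t θ_t(c − v_t) ≤ −T·d_V(v_avg) + R`. -/
theorem soft_dual_regret_feasibility {E : Type*} [NormedAddCommGroup E] [NormedSpace ℝ E]
    [FiniteDimensional ℝ E]
    (V : Set E) (hVne : V.Nonempty) (hVcl : IsClosed V) (hVconv : Convex ℝ V)
    (T : ℕ) (hT : 1 ≤ T)
    (v : ℕ → E) (th : ℕ → E →L[ℝ] ℝ)
    (hth : ∀ t, t < T → inConjDom (fun w => Metric.infDist w V) (th t))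
    (c : E) (hc : c ∈ V) (R : ℝ) (hR : 0 ≤ R)
    (hmd : ∀ θ : E →L[ℝ] ℝ, inConjDom (fun w => Metric.infDist w V) θ →
      ∑ t ∈ Finset.range T,
        (-(th t (v t)) + fenchelConj (fun w => Metric.infDist w V) (th t)
          + θ (v t) - fenchelConj (fun w => Metric.infDist w V) θ) ≤ R) :
    ∑ t ∈ Finset.range T, th t (c - v t) ≤
      -((T : ℝ) * Metric.infDist ((T : ℝ)⁻¹ • ∑ t ∈ Finset.range T, v t) V) + R := by
  obtain ⟨θ, hθ, hle⟩ := exists_infDist_le_sub_fenchelConj hVne hVconv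
    ((T : ℝ)⁻¹ • ∑ t ∈ Finset.range T, v t)
  have hT0 : (0 : ℝ) < T := by exact_mod_cast hT
  have hreg := hmd θ hθ
  have hterm : ∑ t ∈ Finset.range T, th t (c - v t) ≤ ∑ t ∈ Finset.range T,
      (-(th t (v t)) + fenchelConj (fun w => Metric.infDist w V) (th t)) := by
    refine Finset.sum_le_sum fun t ht => ?_
    have := le_fenchelConj (hth t (Finset.mem_range.1 ht)) c
    simp only [Metric.infDist_zero_of_mem hc, sub_zero] at this
    rw [map_sub]
    linarith
  have havg : (T : ℝ) * θ ((T : ℝ)⁻¹ • ∑ t ∈ Finset.range T, v t) =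
      ∑ t ∈ Finset.range T, θ (v t) := by
    rw [map_smul, map_sum, smul_eq_mul, mul_inv_cancel_left₀ hT0.ne']
  rw [Finset.sum_sub_distrib, Finset.sum_add_distrib, Finset.sum_const, Finset.card_range,
    nsmul_eq_mul] at hreg
  have hmul := mul_le_mul_of_nonneg_left hle hT0.le
  rw [mul_sub, havg] at hmul
  linarith
end

section
/- (Deterministic core of the hard-constraint dual regret bound, utility part.) Let E be a finite-dimensional real normed space and let u : E → ℝ be concave and L-Lipschitz with u(0) = 0. Let Λ denote the effective domain of the Fenchel conjugate (−u)*. Let T ≥ 1, let τ be an integer with 1 ≤ τ ≤ T, let v_1, …, v_τ ∈ E, let λ_1, …, λ_τ ∈ Λ be continuous linear functionals, let c ∈ E, and let R ≥ 0. Assume the mirror-descent regret bound: for every λ ∈ Λ, Σ_{t=1}^τ ( −λ_t(v_t) + (−u)*(λ_t) + λ(v_t) − (−u)*(λ) ) ≤ R. Then, with v_avg^τ := (1/T)·Σ_{t=1}^τ v_t, one has Σ_{t=1}^τ λ_t(c − v_t) ≤ −τ·u(c) + T·u(v_avg^τ) + R. -/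
/-- A continuous convex function on a normed space has a subgradient at every point. -/
theorem ConvexOn.exists_subgradient {E : Type*} [NormedAddCommGroup E] [NormedSpace ℝ E]
    {f : E → ℝ} (hf : ConvexOn ℝ Set.univ f) (hcont : Continuous f) (x : E) :
    ∃ l : E →L[ℝ] ℝ, ∀ y, l y - f y ≤ l x - f x := by
  have hopen : IsOpen {p : E × ℝ | p.1 ∈ Set.univ ∧ f p.1 < p.2} := by
    simpa using isOpen_lt (hcont.comp continuous_fst) continuous_snd
  obtain ⟨g, hg⟩ := geometric_hahn_banach_point_open (x := (x, f x))
    hf.convex_strict_epigraph hopen (by simp)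
  have hsplit : ∀ (y : E) (r : ℝ), g (y, r) = g (y, 0) + r * g (0, 1) := by
    intro y r
    rw [← smul_eq_mul, ← map_smul, ← map_add]
    simp
  have hpos : 0 < g (0, 1) := by
    have h := hg (x, f x + 1) ⟨trivial, lt_add_one _⟩
    rw [hsplit x (f x), hsplit x (f x + 1)] at h
    linarith
  have hle : ∀ y, g (x, 0) + f x * g (0, 1) ≤ g (y, 0) + f y * g (0, 1) := by
    intro y
    refine le_of_forall_pos_le_add fun ε hε => ?_
    have h := hg (y, f y + ε / g (0, 1)) ⟨trivial, lt_add_of_pos_right _ (by positivity)⟩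
    rw [hsplit x (f x), hsplit y (f y + _), add_mul, div_mul_cancel₀ _ hpos.ne'] at h
    linarith
  refine ⟨-(g (0, 1))⁻¹ • g.comp (ContinuousLinearMap.inl ℝ E ℝ), fun y => ?_⟩
  have h := mul_le_mul_of_nonneg_left (hle y) (inv_nonneg.2 hpos.le)
  simp only [mul_add, mul_comm (f _) (g (0, 1)), inv_mul_cancel_left₀ hpos.ne'] at h
  simp only [smul_apply, ContinuousLinearMap.comp_apply,
    ContinuousLinearMap.inl_apply, smul_eq_mul, neg_mul]
  linarith

/-- The Fenchel–Young inequality. -/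
theorem inConjDom.sub_le_fenchelConj {E : Type*} [NormedAddCommGroup E] [NormedSpace ℝ E]
    {f : E → ℝ} {θ : E →L[ℝ] ℝ} (h : inConjDom f θ) (x : E) : θ x - f x ≤ fenchelConj f θ :=
  le_csSup h ⟨x, rfl⟩

/-- Deterministic core of the hard-constraint dual regret bound, utility part:
with stopping time `τ ≤ T`, a concave `L`-Lipschitz utility `u` with `u(0) = 0`, and
the mirror-descent regret bound over `Λ = dom (−u)*`, one gets
`Σ_{t<τ} λ_t(c − v_t) ≤ −τ·u(c) + T·u(v_avg^τ) + R`. -/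
theorem hard_dual_regret_utility {E : Type*} [NormedAddCommGroup E] [NormedSpace ℝ E]
    [FiniteDimensional ℝ E]
    (u : E → ℝ) (L : ℝ) (hL : 0 ≤ L)
    (hconc : ConcaveOn ℝ Set.univ u)
    (hLip : ∀ x y : E, |u x - u y| ≤ L * ‖x - y‖)
    (hu0 : u 0 = 0)
    (T τ : ℕ) (hτ1 : 1 ≤ τ) (hτT : τ ≤ T)
    (v : ℕ → E) (lam : ℕ → E →L[ℝ] ℝ)
    (hlam : ∀ t, t < τ → inConjDom (fun w => -u w) (lam t))
    (c : E) (R : ℝ) (hR : 0 ≤ R)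
    (hmd : ∀ l : E →L[ℝ] ℝ, inConjDom (fun w => -u w) l →
      ∑ t ∈ Finset.range τ,
        (-(lam t (v t)) + fenchelConj (fun w => -u w) (lam t)
          + l (v t) - fenchelConj (fun w => -u w) l) ≤ R) :
    ∑ t ∈ Finset.range τ, lam t (c - v t) ≤
      -((τ : ℝ) * u c) + (T : ℝ) * u ((T : ℝ)⁻¹ • ∑ t ∈ Finset.range τ, v t) + R := by
  have hcont : Continuous u :=
    (LipschitzWith.of_dist_le_mul (K := ⟨L, hL⟩) fun x y => by
      rw [Real.dist_eq, dist_eq_norm]; exact hLip x y).continuous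
  set x := (T : ℝ)⁻¹ • ∑ t ∈ Finset.range τ, v t with hx
  obtain ⟨l, hl⟩ := ConvexOn.exists_subgradient (f := fun w => -u w) hconc.neg hcont.neg x
  have hdom : inConjDom (fun w => -u w) l := ⟨l x - -u x, by rintro _ ⟨y, rfl⟩; exact hl y⟩
  have hconj : fenchelConj (fun w => -u w) l ≤ l x + u x :=
    csSup_le (Set.range_nonempty _) (by rintro _ ⟨y, rfl⟩; simpa using hl y)
  have hnonneg : 0 ≤ l x + u x := by simpa [hu0] using hl 0
  have hT : (0 : ℝ) < T := by exact_mod_cast hτ1.trans hτT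
  have hτT' : (τ : ℝ) ≤ T := by exact_mod_cast hτT
  have hlx : ∑ t ∈ Finset.range τ, l (v t) = T * l x := by
    rw [hx, map_smul, map_sum, smul_eq_mul, mul_inv_cancel_left₀ hT.ne']
  have hsum : ∑ t ∈ Finset.range τ, lam t (c - v t) ≤ ∑ t ∈ Finset.range τ,
      ((-(lam t (v t)) + fenchelConj (fun w => -u w) (lam t)
        + l (v t) - fenchelConj (fun w => -u w) l)
        + (fenchelConj (fun w => -u w) l - u c) - l (v t)) := by
    refine Finset.sum_le_sum fun t ht => ?_
    have h := (hlam t (Finset.mem_range.1 ht)).sub_le_fenchelConj c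
    rw [map_sub]
    linarith
  rw [Finset.sum_sub_distrib, Finset.sum_add_distrib, hlx, Finset.sum_const, Finset.card_range,
    nsmul_eq_mul] at hsum
  have hreg := hmd l hdom
  have h₁ := mul_le_mul_of_nonneg_left hconj (Nat.cast_nonneg (α := ℝ) τ)
  have h₂ := mul_le_mul_of_nonneg_right hτT' hnonneg
  linarith
end

section
/- (Exact penalization of the static policy problem.) Let X be a measurable space and let ℙ be a probability measure on X × (ℝ^d × ℝ^{d×m}) whose samples are written (x, r, V); assume there is M > 0 with ‖r‖ ≤ M and ‖V‖ ≤ M ℙ-almost surely. Let S ⊆ ℝ^d be nonempty, convex, and compact, let 𝒱 ⊆ ℝ^m be closed and convex with distance function d_𝒱, and let u : ℝ^m → ℝ be concave. For a measurable policy π : X → S define rew(π) := E_ℙ[rᵀπ(x)] and con(π) := E_ℙ[Vᵀπ(x)], and define OPT := sup { rew(π) + u(con(π)) : π a measurable policy with con(π) ∈ 𝒱 }. Suppose OPT is finite and there exists a measurable policy π° with con(π°) in the interior of 𝒱. Then there exists a constant ζ' ≥ 1 such that OPT = sup over all measurable policies π : X → S of { rew(π) + u(con(π)) − ζ'·d_𝒱(con(π))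 }. -/
open MeasureTheory Matrix

theorem integrable_dotProduct_of_bounded {Ω : Type*} [MeasurableSpace Ω] {μ : Measure Ω}
    [IsFiniteMeasure μ] {d : ℕ} {f g : Ω → Fin d → ℝ} {M C : ℝ}
    (hf : Measurable f) (hg : Measurable g) (hfM : ∀ᵐ ω ∂μ, ∀ i, |f ω i| ≤ M)
    (hgC : ∀ ω, ‖g ω‖ ≤ C) : Integrable (fun ω => f ω ⬝ᵥ g ω) μ := by
  unfold dotProduct
  refine integrable_finsetSum _ fun i _ => ?_
  refine Integrable.of_bound (C := M * C) (by fun_prop) ?_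
  filter_upwards [hfM] with ω hω
  rw [norm_mul]
  exact mul_le_mul (hω i) ((norm_le_pi_norm _ i).trans (hgC ω)) (norm_nonneg _)
    ((abs_nonneg _).trans (hω i))

/-- If `closedBall c₀ ε ⊆ K`, moving any point `c` towards `c₀` by the fraction
`δ / (ε + δ)`, with `δ` its distance to `K`, lands in `K`. -/
theorem Convex.smul_add_smul_mem_of_closedBall_subset {E : Type*} [NormedAddCommGroup E]
    [NormedSpace ℝ E] [ProperSpace E] {K : Set E} (hK : Convex ℝ K) (hcl : IsClosed K)
    {c₀ : E} {ε : ℝ} (hε : 0 < ε) (hball : Metric.closedBall c₀ ε ⊆ K) (c : E) :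
    (ε / (ε + Metric.infDist c K)) • c +
      (Metric.infDist c K / (ε + Metric.infDist c K)) • c₀ ∈ K := by
  have hc₀ : c₀ ∈ K := hball (Metric.mem_closedBall_self hε.le)
  obtain ⟨w, hwK, hw⟩ := hcl.exists_infDist_eq_dist ⟨c₀, hc₀⟩ c
  set δ := Metric.infDist c K with hδ
  have hδ0 : 0 ≤ δ := Metric.infDist_nonneg
  rcases hδ0.eq_or_lt with h | h
  · have : c = w := dist_eq_zero.mp (hw ▸ h.symm)
    rw [← h]
    simpa [hε.ne', this] using hwK
  · have hmem : c₀ + (ε / δ) • (c - w) ∈ K := by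
      apply hball
      rw [mem_closedBall_iff_norm, add_sub_cancel_left, norm_smul, ← dist_eq_norm, ← hw,
        Real.norm_of_nonneg (by positivity), div_mul_cancel₀ _ h.ne']
    have hconv := hK hwK hmem (a := ε / (ε + δ)) (b := δ / (ε + δ)) (by positivity)
      (by positivity) (by field_simp)
    convert hconv using 1
    rw [smul_add, smul_smul, show δ / (ε + δ) * (ε / δ) = ε / (ε + δ) by field_simp, smul_sub]
    abel

/-- Exact penalization of the static policy problem: if `OPT` is finite and some
policy has expected consumption in the interior of `𝒱`, then there is `ζ' ≥ 1` with
`OPT = sup_π { rew(π) + u(con(π)) − ζ'·d_𝒱(con(π)) }`, the sup over all measurable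
policies with values in `S`. -/
theorem exact_penalization_static {X : Type*} [MeasurableSpace X] (d m : ℕ)
    (ℙ : Measure (X × ((Fin d → ℝ) × (Fin d → Fin m → ℝ)))) [IsProbabilityMeasure ℙ]
    (M : ℝ) (hM : 0 < M)
    (hbdd : ∀ᵐ p ∂ℙ, ‖p.2.1‖ ≤ M ∧ ‖p.2.2‖ ≤ M)
    (S : Set (Fin d → ℝ)) (hSne : S.Nonempty) (hSconv : Convex ℝ S) (hScomp : IsCompact S)
    (𝒱 : Set (Fin m → ℝ)) (h𝒱cl : IsClosed 𝒱) (h𝒱conv : Convex ℝ 𝒱)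
    (u : (Fin m → ℝ) → ℝ) (hu : ConcaveOn ℝ Set.univ u)
    (rew : (X → Fin d → ℝ) → ℝ)
    (hrew : ∀ π : X → Fin d → ℝ, rew π = ∫ p, p.2.1 ⬝ᵥ π p.1 ∂ℙ)
    (con : (X → Fin d → ℝ) → (Fin m → ℝ))
    (hcon : ∀ π : X → Fin d → ℝ, con π = ∫ p, (fun j => (fun i => p.2.2 i j) ⬝ᵥ π p.1) ∂ℙ)
    (OPT : ℝ)
    (hOPT : OPT = sSup {z : ℝ | ∃ π : X → Fin d → ℝ, Measurable π ∧ (∀ x, π x ∈ S) ∧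
      con π ∈ 𝒱 ∧ z = rew π + u (con π)})
    (hfin : BddAbove {z : ℝ | ∃ π : X → Fin d → ℝ, Measurable π ∧ (∀ x, π x ∈ S) ∧
      con π ∈ 𝒱 ∧ z = rew π + u (con π)})
    (π₀ : X → Fin d → ℝ) (hπ₀meas : Measurable π₀) (hπ₀S : ∀ x, π₀ x ∈ S)
    (hπ₀int : con π₀ ∈ interior 𝒱) :
    ∃ ζ' : ℝ, 1 ≤ ζ' ∧
      OPT = sSup {z : ℝ | ∃ π : X → Fin d → ℝ, Measurable π ∧ (∀ x, π x ∈ S) ∧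
        z = rew π + u (con π) - ζ' * Metric.infDist (con π) 𝒱} := by
  obtain ⟨C, hC⟩ := hScomp.isBounded.exists_norm_le
  have hint_rew : ∀ π : X → Fin d → ℝ, Measurable π → (∀ x, π x ∈ S) →
      Integrable (fun p => p.2.1 ⬝ᵥ π p.1) ℙ := fun π hπ hπS =>
    integrable_dotProduct_of_bounded (M := M) (by fun_prop) (by fun_prop)
      (hbdd.mono fun p hp i => (norm_le_pi_norm _ i).trans hp.1) fun p => hC _ (hπS p.1)
  have hint_con : ∀ π : X → Fin d → ℝ, Measurable π → (∀ x, π x ∈ S) →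
      Integrable (fun p j => (fun i => p.2.2 i j) ⬝ᵥ π p.1 : _ → Fin m → ℝ) ℙ := fun π hπ hπS =>
    Integrable.of_eval fun j =>
      integrable_dotProduct_of_bounded (f := fun p i => p.2.2 i j) (M := M)
      (by fun_prop) (by fun_prop)
      (hbdd.mono fun p hp i =>
        ((norm_le_pi_norm (p.2.2 i) j).trans (norm_le_pi_norm p.2.2 i)).trans hp.2)
      fun p => hC _ (hπS p.1)
  have hrew_lin : ∀ π : X → Fin d → ℝ, Measurable π → (∀ x, π x ∈ S) → ∀ a b : ℝ,
      rew (a • π + b • π₀) = a * rew π + b * rew π₀ := by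
    intro π hπ hπS a b
    simp only [hrew, ← integral_const_mul]
    rw [← integral_add ((hint_rew π hπ hπS).const_mul a)
      ((hint_rew π₀ hπ₀meas hπ₀S).const_mul b)]
    simp [dotProduct_add, dotProduct_smul]
  have hcon_lin : ∀ π : X → Fin d → ℝ, Measurable π → (∀ x, π x ∈ S) → ∀ a b : ℝ,
      con (a • π + b • π₀) = a • con π + b • con π₀ := by
    intro π hπ hπS a b
    simp only [hcon, ← integral_smul]
    refine Eq.trans (integral_congr_ae (.of_forall fun p => ?_))
      (integral_add ((hint_con π hπ hπS).smul a) ((hint_con π₀ hπ₀meas hπ₀S).smul b))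
    ext j
    simp [dotProduct_add, dotProduct_smul]
  obtain ⟨ε, hε, hball⟩ := Metric.nhds_basis_closedBall.mem_iff.mp
    (mem_interior_iff_mem_nhds.mp hπ₀int)
  have hOPT_le : ∀ π : X → Fin d → ℝ, Measurable π → (∀ x, π x ∈ S) → con π ∈ 𝒱 →
      rew π + u (con π) ≤ OPT := fun π hπ hπS hπ𝒱 =>
    hOPT ▸ le_csSup hfin ⟨π, hπ, hπS, hπ𝒱, rfl⟩
  set f₀ := rew π₀ + u (con π₀) with hf₀
  have hupper : ∀ π : X → Fin d → ℝ, Measurable π → (∀ x, π x ∈ S) →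
      rew π + u (con π) - max 1 ((OPT - f₀) / ε) * Metric.infDist (con π) 𝒱 ≤ OPT := by
    intro π hπ hπS
    have hmem := h𝒱conv.smul_add_smul_mem_of_closedBall_subset h𝒱cl hε hball (con π)
    have hδ : 0 ≤ Metric.infDist (con π) 𝒱 := Metric.infDist_nonneg
    set δ := Metric.infDist (con π) 𝒱
    have ha : 0 ≤ ε / (ε + δ) := by positivity
    have hb : 0 ≤ δ / (ε + δ) := by positivity
    have hab : ε / (ε + δ) + δ / (ε + δ) = 1 := by field_simp
    have hle := hOPT_le ((ε / (ε + δ)) • π + (δ / (ε + δ)) • π₀) (by fun_prop)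
      (fun x => hSconv (hπS x) (hπ₀S x) ha hb hab) (by rwa [hcon_lin π hπ hπS])
    rw [hcon_lin π hπ hπS, hrew_lin π hπ hπS] at hle
    have hu' := hu.2 (Set.mem_univ (con π)) (Set.mem_univ (con π₀)) ha hb hab
    simp only [smul_eq_mul] at hu'
    have hmix : ε / (ε + δ) * (rew π + u (con π)) + δ / (ε + δ) * f₀ ≤ OPT := by
      rw [hf₀]; linarith
    have hscaled : ε * (rew π + u (con π)) + δ * f₀ ≤ OPT * (ε + δ) := by
      refine (div_le_iff₀ (by positivity)).mp (le_of_eq_of_le ?_ hmix)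
      ring
    have hbound : rew π + u (con π) ≤ OPT + (OPT - f₀) / ε * δ := by
      have : OPT + (OPT - f₀) / ε * δ = (OPT * (ε + δ) - δ * f₀) / ε := by
        field_simp
        ring
      rw [this, le_div_iff₀ hε]
      linarith
    have := mul_le_mul_of_nonneg_right (le_max_right 1 ((OPT - f₀) / ε)) hδ
    linarith
  refine ⟨max 1 ((OPT - f₀) / ε), le_max_left _ _, le_antisymm ?_ ?_⟩
  · rw [hOPT]
    refine csSup_le_csSup ⟨OPT, ?_⟩
      ⟨_, π₀, hπ₀meas, hπ₀S, interior_subset hπ₀int, rfl⟩ ?_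
    · rintro _ ⟨π, hπ, hπS, rfl⟩
      simpa only [← hOPT] using hupper π hπ hπS
    · rintro _ ⟨π, hπ, hπS, hπ𝒱, rfl⟩
      exact ⟨π, hπ, hπS, by rw [Metric.infDist_zero_of_mem hπ𝒱, mul_zero, sub_zero]⟩
  · refine csSup_le ⟨_, π₀, hπ₀meas, hπ₀S, rfl⟩ ?_
    rintro _ ⟨π, hπ, hπS, rfl⟩
    exact hupper π hπ hπS
end
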